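/- Let m, n be positive natural numbers and let A, B : Fin n → ZMod 2 be fixed vectors with A ≠ B. If M is a matrix drawn uniformly at random from Matrix (Fin m) (Fin n) (ZMod 2), then the probability that M.mulVec A = M.mulVec B is exactly 2^(-m). (Soundness of the one-round Equality protocol: the probability of a false positive is 2^(-m), and there are no false negatives since A = B always yields M.mulVec A = M.mulVec B.) -/

import Mathlib

open scoped ENNReal

theorem Matrix.mulVec_left_surjective {ι κ K : Type*} [Fintype κ] [Field K]
    {v : κ → K} (hv : v ≠ 0) :
    Function.Surjective fun M : Matrix ι κ K => M.mulVec v := by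
  classical
  obtain ⟨j, hj⟩ := Function.ne_iff.mp hv
  have hj : v j ≠ 0 := hj
  intro w
  refine ⟨Matrix.vecMulVec w (Pi.single j (v j)⁻¹), ?_⟩
  ext i
  simp [Matrix.vecMulVec_mulVec, hj]

theorem Matrix.card_mulVec_eq_zero_mul {ι κ K : Type*} [Fintype κ] [Field K]
    {v : κ → K} (hv : v ≠ 0) :
    Nat.card {M : Matrix ι κ K | M.mulVec v = 0} * Nat.card (ι → K) =
      Nat.card (Matrix ι κ K) := by
  let f : Matrix ι κ K →+ (ι → K) :=
    { toFun := fun M => M.mulVec v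
      map_zero' := Matrix.zero_mulVec v
      map_add' := fun M N => Matrix.add_mulVec M N v }
  have hf : Function.Surjective f := Matrix.mulVec_left_surjective hv
  have h := f.ker.card_mul_index
  rw [AddSubgroup.index_ker, AddMonoidHom.range_eq_top.mpr hf, AddSubgroup.card_top] at h
  exact h

/-- Soundness of the one-round Equality protocol: if `A ≠ B` are fixed vectors and `M` is an
`m × n` matrix drawn uniformly at random over `ZMod 2`, then the probability that
`M.mulVec A = M.mulVec B` (a false positive) is exactly `2^(-m)`. -/
theorem stmt_1 (m n : ℕ) (hm : 0 < m) (hn : 0 < n)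
    (A B : Fin n → ZMod 2) (hAB : A ≠ B) :
    (PMF.uniformOfFintype (Matrix (Fin m) (Fin n) (ZMod 2))).toOuterMeasure
      {M : Matrix (Fin m) (Fin n) (ZMod 2) | M.mulVec A = M.mulVec B} = 2 ^ (-(m : ℤ)) := by
  classical
  have hset : {M : Matrix (Fin m) (Fin n) (ZMod 2) | M.mulVec A = M.mulVec B} =
      {M | M.mulVec (A - B) = 0} := by
    ext M
    simp [Matrix.mulVec_sub, sub_eq_zero]
  have hcard := Matrix.card_mulVec_eq_zero_mul (ι := Fin m) (sub_ne_zero.mpr hAB)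
  have hpow : Nat.card (Fin m → ZMod 2) = 2 ^ m := by simp
  have hpos : Nat.card {M : Matrix (Fin m) (Fin n) (ZMod 2) | M.mulVec (A - B) = 0} ≠ 0 := by
    intro h
    rw [h, zero_mul] at hcard
    exact Nat.card_pos.ne hcard
  rw [hset, PMF.toOuterMeasure_uniformOfFintype_apply, ← Nat.card_eq_fintype_card,
    ← Nat.card_eq_fintype_card, ← hcard, hpow, Nat.cast_mul, ENNReal.zpow_neg, zpow_natCast]
  simpa using ENNReal.mul_div_mul_left 1 ((2 ^ m : ℕ) : ℝ≥0∞)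
    (Nat.cast_ne_zero.mpr hpos) (ENNReal.natCast_ne_top _)
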